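/- Fix γ > −1. For all n ≥ 0 and 0 ≤ k ≤ n, the ratio of squared norms ‖G_{n,k}^γ‖²_{L²(𝔻, d^γ dz)} / ‖ψ_{n,k}^γ‖²_{L²(∂₊S𝔻, μ^{−2γ} dβ dα)} equals 2^{2γ+2} π binom(n,k) Γ(n−k+γ+1)Γ(k+γ+1)/Γ(n+2γ+2). -/

import Mathlib

open MeasureTheory Complex Metric Real Set

noncomputable section

/-! ## Geometry of the Euclidean disk and its space of lines (fan-beam coordinates) -/

/-- The chord of the closed unit disk through the boundary point `exp (I β)` with incoming
direction `exp (I (β + π + α))`, parametrized by arclength `t ∈ [0, 2 cos α]`. -/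
def chord (β α t : ℝ) : ℂ :=
  Complex.exp ((β : ℂ) * Complex.I) +
    (t : ℂ) * Complex.exp (((β + π + α : ℝ) : ℂ) * Complex.I)

/-- The X-ray transform `I₀` in fan-beam coordinates. -/
def XRT (f : ℂ → ℂ) (β α : ℝ) : ℂ :=
  ∫ t in (0:ℝ)..(2 * Real.cos α), f (chord β α t)

/-- The fan-beam coordinate `α₋(z, θ)` of the unique chord through `z` with direction `exp (I θ)`,
determined by `sin α₋ = Im (z * exp (-I θ))`. -/
def alpham (z : ℂ) (θ : ℝ) : ℝ :=
  Real.arcsin ((z * Complex.exp (-(θ : ℂ) * Complex.I)).im)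

/-- The fan-beam coordinate `β₋(z, θ)`, determined by `β₋ + α₋ + π = θ`. -/
def betam (z : ℂ) (θ : ℝ) : ℝ := θ - π - alpham z θ

/-- Reduction modulo `2π` to the fundamental interval `(0, 2π]`. -/
def wrap (x : ℝ) : ℝ := toIocMod Real.two_pi_pos 0 x

/-- The backprojection operator `I₀^♯`. -/
def BP (g : ℝ × ℝ → ℂ) (z : ℂ) : ℂ :=
  ∫ θ in (0:ℝ)..(2 * π), g (wrap (betam z θ), alpham z θ)

/-- The weighted backprojection operator `I₀^♯ μ^{-2γ-1}`, where `μ(β, α) = cos α`. -/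
def BPW (γ : ℝ) (g : ℝ × ℝ → ℂ) : ℂ → ℂ :=
  BP fun p => ((Real.cos p.2 ^ (-(2 * γ) - 1) : ℝ) : ℂ) * g p

/-- The rectangle `(0, 2π] × [-π/2, π/2]` modelling the space of lines `∂₊S𝔻`. -/
def Rect : Set (ℝ × ℝ) := Set.Ioc (0:ℝ) (2 * π) ×ˢ Set.Icc (-(π / 2)) (π / 2)

/-- The measure `μ^{-2γ} dβ dα` on `∂₊S𝔻`, where `μ(β, α) = cos α`. -/
def bdryMeasure (γ : ℝ) : Measure (ℝ × ℝ) :=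
  ((volume : Measure (ℝ × ℝ)).restrict Rect).withDensity
    fun p => ENNReal.ofReal (Real.cos p.2 ^ (-(2 * γ)))

/-- The measure `d^γ dz` on the closed unit disk, where `d(z) = 1 - |z|²`. -/
def diskMeasure (γ : ℝ) : Measure ℂ :=
  ((volume : Measure ℂ).restrict (Metric.closedBall 0 1)).withDensity
    fun z => ENNReal.ofReal ((1 - ‖z‖ ^ 2) ^ γ)

/-- `L n` is the monic orthogonal polynomial of degree `n` on `[-1, 1]` for the weight
`(1 - x²)^(γ + 1/2)`. -/
def IsMonicOrtho (γ : ℝ) (L : ℕ → Polynomial ℝ) : Prop :=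
  ∀ n, (L n).Monic ∧ (L n).natDegree = n ∧
    ∀ m, m < n →
      (∫ x in (-1:ℝ)..(1:ℝ), (L n).eval x * x ^ m * (1 - x ^ 2) ^ (γ + 1/2)) = 0

/-- The functions `ψ_{n,k}^γ = μ^{2γ+1} ((-1)^n / 2π) e^{i(n-2k)(β+α)} L_n^γ (sin α)`. -/
def psiF (γ : ℝ) (L : ℕ → Polynomial ℝ) (n : ℕ) (k : ℤ) (p : ℝ × ℝ) : ℂ :=
  ((Real.cos p.2 ^ (2 * γ + 1) : ℝ) : ℂ) * (((-1 : ℝ) ^ n / (2 * π) : ℝ) : ℂ) *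
    Complex.exp (Complex.I * ((n : ℂ) - 2 * (k : ℂ)) * ((p.1 + p.2 : ℝ) : ℂ)) *
    (((L n).eval (Real.sin p.2) : ℝ) : ℂ)

/-- The generalized Zernike polynomials
`G_{n,k}^γ (z) = (1/2π) ∫₀^{2π} e^{i(n-2k)θ} L_n^γ ((i/2)(z̄ e^{iθ} - z e^{-iθ})) dθ`. -/
def GZ (γ : ℝ) (L : ℕ → Polynomial ℝ) (n : ℕ) (k : ℤ) (z : ℂ) : ℂ :=
  ((1 / (2 * π) : ℝ) : ℂ) * ∫ θ in (0:ℝ)..(2 * π),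
    Complex.exp (Complex.I * ((n : ℂ) - 2 * (k : ℂ)) * (θ : ℂ)) *
      Polynomial.aeval
        ((Complex.I / 2) *
          ((starRingEnd ℂ) z * Complex.exp ((θ : ℂ) * Complex.I) -
            z * Complex.exp (-(θ : ℂ) * Complex.I))) (L n)

/-- `L²(𝔻, d^γ dz)`-norm. -/
def dNorm (γ : ℝ) (f : ℂ → ℂ) : ℝ := Real.sqrt (∫ z, ‖f z‖ ^ 2 ∂(diskMeasure γ))

/-- `L²(∂₊S𝔻, μ^{-2γ} dβ dα)`-norm. -/
def bNorm (γ : ℝ) (g : ℝ × ℝ → ℂ) : ℝ := Real.sqrt (∫ p, ‖g p‖ ^ 2 ∂(bdryMeasure γ))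

/-- `G_{n,k}^γ` normalized to unit norm in `L²(𝔻, d^γ dz)`. -/
def Ghat (γ : ℝ) (L : ℕ → Polynomial ℝ) (n : ℕ) (k : ℤ) (z : ℂ) : ℂ :=
  (((dNorm γ (GZ γ L n k))⁻¹ : ℝ) : ℂ) * GZ γ L n k z

/-- `ψ_{n,k}^γ` normalized to unit norm in `L²(∂₊S𝔻, μ^{-2γ} dβ dα)`. -/
def psihat (γ : ℝ) (L : ℕ → Polynomial ℝ) (n : ℕ) (k : ℤ) (p : ℝ × ℝ) : ℂ :=
  (((bNorm γ (psiF γ L n k))⁻¹ : ℝ) : ℂ) * psiF γ L n k p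

/-- The squared singular values `(σ_{n,k}^γ)²`. -/
def sigSq (γ : ℝ) (n k : ℕ) : ℝ :=
  2 ^ (2 * γ + 2) * π * (n.choose k) *
    Real.Gamma ((n : ℝ) - k + γ + 1) * Real.Gamma ((k : ℝ) + γ + 1) /
      Real.Gamma ((n : ℝ) + 2 * γ + 2)

/-- The singular values `σ_{n,k}^γ ≥ 0`. -/
def sig (γ : ℝ) (n k : ℕ) : ℝ := Real.sqrt (sigSq γ n k)

/-- The Beta function `B(x,y) = Γ(x)Γ(y)/Γ(x+y)`. -/
def betaFn (x y : ℝ) : ℝ := Real.Gamma x * Real.Gamma y / Real.Gamma (x + y)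

/-! ## Differential operators -/

/-- Radial derivative `∂_ρ` in polar coordinates `z = ρ e^{iω}`. -/
def dRho (f : ℂ → ℂ) (z : ℂ) : ℂ :=
  deriv (fun r : ℝ => f ((r : ℂ) * Complex.exp ((z.arg : ℂ) * Complex.I))) ‖z‖

/-- Angular derivative `∂_ω` in polar coordinates `z = ρ e^{iω}`. -/
def dOmega (f : ℂ → ℂ) (z : ℂ) : ℂ :=
  deriv (fun w : ℝ => f ((‖z‖ : ℂ) * Complex.exp ((w : ℂ) * Complex.I))) z.arg

/-- The operator `𝓛_γ = -(1-ρ²)∂_ρ² - (ρ⁻¹ - (3+2γ)ρ)∂_ρ - ρ⁻²∂_ω² + (γ+1)²`. -/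
def Lop (γ : ℝ) (f : ℂ → ℂ) (z : ℂ) : ℂ :=
  -(1 - (‖z‖ : ℂ) ^ 2) * dRho (dRho f) z -
    ((‖z‖ : ℂ)⁻¹ - (3 + 2 * (γ : ℂ)) * (‖z‖ : ℂ)) * dRho f z -
    ((‖z‖ : ℂ) ^ 2)⁻¹ * dOmega (dOmega f) z + ((γ : ℂ) + 1) ^ 2 * f z

/-- `∂_β` on `∂₊S𝔻`. -/
def dBeta (g : ℝ × ℝ → ℂ) (p : ℝ × ℝ) : ℂ := deriv (fun b : ℝ => g (b, p.2)) p.1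

/-- `∂_α` on `∂₊S𝔻`. -/
def dAlpha (g : ℝ × ℝ → ℂ) (p : ℝ × ℝ) : ℂ := deriv (fun a : ℝ => g (p.1, a)) p.2

/-- The operator `T = ∂_β - ∂_α`. -/
def Tline (g : ℝ × ℝ → ℂ) (p : ℝ × ℝ) : ℂ := dBeta g p - dAlpha g p

/-- The power `μ^e = (cos α)^e` as a complex-valued function on `∂₊S𝔻`. -/
def muC (e : ℝ) (p : ℝ × ℝ) : ℂ := ((Real.cos p.2 ^ e : ℝ) : ℂ)

/-- The operator `𝓣_γ = -μ^{2γ} T μ^{-2γ} T + γ²`. -/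
def Tgam (γ : ℝ) (g : ℝ × ℝ → ℂ) (p : ℝ × ℝ) : ℂ :=
  -muC (2 * γ) p * Tline (fun q => muC (-(2 * γ)) q * Tline g q) p + (γ : ℂ) ^ 2 * g p

/-! ## Scattering relations and the space `C^∞_{α,+,+}(∂₊S𝔻)` -/

/-- The scattering relation `𝒮(β, α) = (β + π + 2α, π - α)`. -/
def Scat (p : ℝ × ℝ) : ℝ × ℝ := (p.1 + π + 2 * p.2, π - p.2)

/-- The antipodal scattering relation `𝒮_A(β, α) = (β + π + 2α, -α)`. -/
def ScatA (p : ℝ × ℝ) : ℝ × ℝ := (p.1 + π + 2 * p.2, -p.2)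

/-- Membership in `C^∞_{α,+,+}(∂₊S𝔻)`: `f`, given on the strip `ℝ × [-π/2, π/2]` (2π-periodically
in β), has an even extension through the scattering relation which is smooth on all of `∂S𝔻`
(modelled as a doubly 2π-periodic smooth function on `ℝ²` invariant under `𝒮`), and `f` is
invariant under the antipodal scattering relation. -/
def MemCapp (f : ℝ × ℝ → ℂ) : Prop :=
  ∃ F : ℝ × ℝ → ℂ, ContDiff ℝ (⊤ : ℕ∞) F ∧
    (∀ p : ℝ × ℝ, F (p.1 + 2 * π, p.2) = F p) ∧
    (∀ p : ℝ × ℝ, F (p.1, p.2 + 2 * π) = F p) ∧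
    (∀ p : ℝ × ℝ, F (Scat p) = F p) ∧
    (∀ p : ℝ × ℝ, p.2 ∈ Set.Icc (-(π / 2)) (π / 2) → F (ScatA p) = F p) ∧
    (∀ p : ℝ × ℝ, p.2 ∈ Set.Icc (-(π / 2)) (π / 2) → f p = F p)

/-- `C^∞(𝔻)`: smooth up to the boundary of the closed unit disk. -/
def CinfDisk (f : ℂ → ℂ) : Prop := ContDiffOn ℝ (⊤ : ℕ∞) f (Metric.closedBall 0 1)

end

noncomputable section

/-- The Jacobi weight integral `∫_{-1}^1 (1 + s)^b (1 - s)^a ds` in terms of Gamma functions. -/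
lemma integral_jacobi_weight {a b : ℝ} (ha : -1 < a) (hb : -1 < b) :
    ∫ s in (-1:ℝ)..1, (1 + s) ^ b * (1 - s) ^ a =
      2 ^ (a + b + 1) * (Real.Gamma (a + 1) * Real.Gamma (b + 1) / Real.Gamma (a + b + 2)) := by
  have h1 := Complex.betaIntegral_scaled ((b + 1 : ℝ) : ℂ) ((a + 1 : ℝ) : ℂ) (a := 2) two_pos
  rw [Complex.betaIntegral_eq_Gamma_mul_div _ _ (by simp; linarith) (by simp; linarith)] at h1
  have h2 : ∫ s in (-1:ℝ)..1, (1 + s) ^ b * (1 - s) ^ a =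
      ∫ x in (0:ℝ)..2, x ^ b * (2 - x) ^ a := by
    have := intervalIntegral.integral_comp_add_left (a := -1) (b := 1)
      (fun x : ℝ => x ^ b * (2 - x) ^ a) 1
    norm_num at this
    rw [← this]
    congr 1; ext s; ring_nf
  have h3 : ∫ x in (0:ℝ)..2, (x : ℂ) ^ (((b + 1 : ℝ) : ℂ) - 1) *
      (((2 : ℝ) : ℂ) - x) ^ (((a + 1 : ℝ) : ℂ) - 1) =
      ((∫ x in (0:ℝ)..2, x ^ b * (2 - x) ^ a : ℝ) : ℂ) := by
    rw [← intervalIntegral.integral_ofReal]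
    refine intervalIntegral.integral_congr fun x hx => ?_
    rw [Set.uIcc_of_le (by norm_num)] at hx
    rw [Complex.ofReal_mul, Complex.ofReal_cpow hx.1, Complex.ofReal_cpow (by linarith [hx.2])]
    push_cast
    simp
  rw [h2]
  rw [h3] at h1
  have h4 : ((2 : ℝ) : ℂ) ^ (((b + 1 : ℝ) : ℂ) + ((a + 1 : ℝ) : ℂ) - 1) =
      (((2:ℝ) ^ (a + b + 1) : ℝ) : ℂ) := by
    rw [Complex.ofReal_cpow (by norm_num)]
    push_cast
    ring_nf
  rw [h4, ← Complex.ofReal_add, Complex.Gamma_ofReal, Complex.Gamma_ofReal,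
    Complex.Gamma_ofReal] at h1
  have h5 : b + 1 + (a + 1) = a + b + 2 := by ring
  rw [h5] at h1
  have h6 := Complex.ofReal_injective (h1.trans (by push_cast; rfl :
    _ = (((2:ℝ) ^ (a + b + 1) * (Real.Gamma (b + 1) * Real.Gamma (a + 1) /
      Real.Gamma (a + b + 2)) : ℝ) : ℂ)))
  rw [h6, mul_comm (Real.Gamma (b + 1))]

lemma intervalIntegrable_jacobi_weight {a b : ℝ} (ha : -1 < a) (hb : -1 < b) :
    IntervalIntegrable (fun s : ℝ => (1 + s) ^ b * (1 - s) ^ a) volume (-1) 1 := by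
  by_contra h
  have h0 := intervalIntegral.integral_undef h
  rw [integral_jacobi_weight ha hb] at h0
  have h1 := Real.Gamma_pos_of_pos (s := a + 1) (by linarith)
  have h2 := Real.Gamma_pos_of_pos (s := b + 1) (by linarith)
  have h3 := Real.Gamma_pos_of_pos (s := a + b + 2) (by linarith)
  have : 0 < (2:ℝ) ^ (a + b + 1) *
      (Real.Gamma (a + 1) * Real.Gamma (b + 1) / Real.Gamma (a + b + 2)) := by positivity
  linarith

/-- The weight `(1 - s²)^a` on `[-1, 1]`, extended by zero. -/
def gegW (a s : ℝ) : ℝ := (Set.Icc (-1) 1).indicator (fun s : ℝ => (1 - s ^ 2) ^ a) s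

lemma gegW_of_mem {a s : ℝ} (hs : s ∈ Set.Icc (-1 : ℝ) 1) : gegW a s = (1 - s ^ 2) ^ a :=
  Set.indicator_of_mem hs _

lemma gegW_of_notMem {a s : ℝ} (hs : s ∉ Set.Icc (-1 : ℝ) 1) : gegW a s = 0 :=
  Set.indicator_of_notMem hs _

lemma gegW_nonneg (a s : ℝ) : 0 ≤ gegW a s := by
  refine Set.indicator_nonneg (fun s hs => Real.rpow_nonneg ?_ _) s
  nlinarith [hs.1, hs.2]

lemma gegW_neg (a s : ℝ) : gegW a (-s) = gegW a s := by
  have : -s ∈ Set.Icc (-1 : ℝ) 1 ↔ s ∈ Set.Icc (-1 : ℝ) 1 := by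
    simp only [Set.mem_Icc]; constructor <;> rintro ⟨h1, h2⟩ <;> constructor <;> linarith
  unfold gegW Set.indicator
  simp only [this, neg_sq]

@[fun_prop]
lemma measurable_gegW (a : ℝ) : Measurable (gegW a) :=
  Measurable.indicator (by fun_prop) measurableSet_Icc

lemma one_sub_sq_rpow {s : ℝ} (hs : s ∈ Set.Icc (-1 : ℝ) 1) (a : ℝ) :
    (1 - s ^ 2) ^ a = (1 + s) ^ a * (1 - s) ^ a := by
  rw [← Real.mul_rpow (by linarith [hs.1]) (by linarith [hs.2])]
  ring_nf

lemma integrable_gegW {a : ℝ} (ha : -1 < a) : Integrable (gegW a) := by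
  have h := intervalIntegrable_jacobi_weight ha ha
  rw [intervalIntegrable_iff_integrableOn_Icc_of_le (by norm_num)] at h
  rw [show gegW a = (Set.Icc (-1) 1).indicator (fun s : ℝ => (1 - s ^ 2) ^ a) from rfl,
    integrable_indicator_iff measurableSet_Icc]
  exact h.congr_fun (fun s hs => (one_sub_sq_rpow hs a).symm) measurableSet_Icc

lemma integrable_gegW_mul {a : ℝ} (ha : -1 < a) {f : ℝ → ℂ} (hf : Continuous f) :
    Integrable fun s => (gegW a s : ℂ) * f s := by
  obtain ⟨C, hC⟩ := (isCompact_Icc (a := (-1:ℝ)) (b := 1)).exists_bound_of_continuousOn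
    hf.continuousOn
  refine ((integrable_gegW ha).const_mul C).mono' (by fun_prop) (ae_of_all _ fun s => ?_)
  rw [norm_mul, Complex.norm_real, Real.norm_of_nonneg (gegW_nonneg a s)]
  by_cases hs : s ∈ Set.Icc (-1 : ℝ) 1
  · rw [mul_comm]
    exact mul_le_mul_of_nonneg_right (hC s hs) (gegW_nonneg a s)
  · simp [gegW_of_notMem hs]

/-- The odd moments of `(1 - s²)^a` vanish. -/
lemma integral_gegW_mul_pow_of_odd (a : ℝ) {i : ℕ} (hi : Odd i) :
    ∫ s, (gegW a s : ℂ) * (s : ℂ) ^ i = 0 := by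
  have h := integral_neg_eq_self (fun s : ℝ => (gegW a s : ℂ) * (s : ℂ) ^ i) volume
  simp only [gegW_neg, Complex.ofReal_neg, hi.neg_pow, mul_neg, integral_neg] at h
  exact self_eq_neg.mp h.symm

lemma integral_gegW_mul (a : ℝ) (f : ℝ → ℂ) :
    ∫ s, (gegW a s : ℂ) * f s = ∫ s in (-1:ℝ)..1, (((1 - s ^ 2) ^ a : ℝ) : ℂ) * f s := by
  rw [intervalIntegral.integral_of_le (by norm_num), ← integral_Icc_eq_integral_Ioc,
    ← integral_indicator measurableSet_Icc]
  congr 1; ext s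
  by_cases hs : s ∈ Set.Icc (-1 : ℝ) 1
  · rw [Set.indicator_of_mem hs, gegW_of_mem hs]
  · rw [Set.indicator_of_notMem hs, gegW_of_notMem hs]; simp

/-- `∫ (1 - s²)^γ ((1 - s)/2)^p ((1 + s)/2)^q ds` as a Gamma quotient. -/
lemma integral_gegW_bernstein {γ : ℝ} (hγ : -1 < γ) (p q : ℕ) :
    ∫ s, (gegW γ s : ℂ) * (((1 - s) / 2) ^ p * ((1 + s) / 2) ^ q) =
      ((2 ^ (2 * γ + 1) * (Real.Gamma (p + γ + 1) * Real.Gamma (q + γ + 1) /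
        Real.Gamma (p + q + 2 * γ + 2)) : ℝ) : ℂ) := by
  have hp : (0:ℝ) ≤ p := p.cast_nonneg
  have hq : (0:ℝ) ≤ q := q.cast_nonneg
  have h1 := integral_jacobi_weight (a := p + γ) (b := q + γ) (by linarith) (by linarith)
  have h2 : (2:ℝ) ^ (p + γ + (q + γ) + 1) = 2 ^ (2 * γ + 1) * (2 ^ p * 2 ^ q) := by
    rw [← Real.rpow_natCast, ← Real.rpow_natCast, ← Real.rpow_add two_pos,
      ← Real.rpow_add two_pos]
    ring_nf
  have h3 : (p:ℝ) + γ + (q + γ) + 2 = p + q + 2 * γ + 2 := by ring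
  rw [h2, h3] at h1
  have h4 : ∫ s in (-1:ℝ)..1, (1 + s) ^ ((q:ℝ) + γ) * (1 - s) ^ ((p:ℝ) + γ) =
      (2 ^ p * 2 ^ q) * ∫ s in (-1:ℝ)..1, (1 - s ^ 2) ^ γ *
        (((1 - s) / 2) ^ p * ((1 + s) / 2) ^ q) := by
    rw [← intervalIntegral.integral_const_mul]
    refine intervalIntegral.integral_congr_ae ?_
    have hne : ∀ᵐ s : ℝ, s ≠ 1 := Measure.ae_ne volume 1
    filter_upwards [hne] with s hs1 hs
    rw [Set.uIoc_of_le (by norm_num)] at hs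
    have hs1' : s < 1 := lt_of_le_of_ne hs.2 hs1
    rw [one_sub_sq_rpow ⟨hs.1.le, hs.2⟩, Real.rpow_add (by linarith [hs.1]),
      Real.rpow_add (by linarith), Real.rpow_natCast, Real.rpow_natCast, div_pow, div_pow]
    field_simp
  rw [integral_gegW_mul]
  have h5 : ∀ s : ℝ, (((1 - s ^ 2) ^ γ : ℝ) : ℂ) * (((1 - s) / 2) ^ p * ((1 + s) / 2) ^ q) =
      (((1 - s ^ 2) ^ γ * (((1 - s) / 2) ^ p * ((1 + s) / 2) ^ q) : ℝ) : ℂ) := by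
    intro s; push_cast; rfl
  simp only [h5]
  rw [intervalIntegral.integral_ofReal]
  congr 1
  rw [h4] at h1
  have h6 : (2:ℝ) ^ p * 2 ^ q ≠ 0 := by positivity
  apply mul_left_cancel₀ h6
  rw [h1]; ring

/-- The weight `(1 - u² - x²)^γ` on the closed unit disk, extended by zero. -/
def discW (γ u x : ℝ) : ℝ := if u ^ 2 + x ^ 2 ≤ 1 then (1 - (u ^ 2 + x ^ 2)) ^ γ else 0

lemma discW_nonneg (γ u x : ℝ) : 0 ≤ discW γ u x := by
  unfold discW
  split_ifs with h
  · exact Real.rpow_nonneg (by linarith) _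
  · exact le_rfl

lemma measurable_discW (γ : ℝ) : Measurable fun p : ℝ × ℝ => discW γ p.1 p.2 :=
  Measurable.ite (measurableSet_le (by fun_prop) (by fun_prop)) (by fun_prop) (by fun_prop)

lemma discW_sqrt_mul (γ : ℝ) {x : ℝ} (hx : 0 < 1 - x ^ 2) (s : ℝ) :
    discW γ (√(1 - x ^ 2) * s) x = (1 - x ^ 2) ^ γ * gegW γ s := by
  have h1 : (√(1 - x ^ 2) * s) ^ 2 = (1 - x ^ 2) * s ^ 2 := by
    rw [mul_pow, Real.sq_sqrt hx.le]
  have h2 : (√(1 - x ^ 2) * s) ^ 2 + x ^ 2 ≤ 1 ↔ s ∈ Set.Icc (-1 : ℝ) 1 := by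
    rw [h1, Set.mem_Icc, ← abs_le, ← sq_le_one_iff_abs_le_one]
    constructor <;> intro h <;> nlinarith
  by_cases hs : s ∈ Set.Icc (-1 : ℝ) 1
  · rw [discW, if_pos (h2.mpr hs), gegW_of_mem hs, ← Real.mul_rpow hx.le
      (by nlinarith [hs.1, hs.2]), h1]
    ring_nf
  · rw [discW, if_neg (h2.not.mpr hs), gegW_of_notMem hs, mul_zero]

lemma discW_of_neg (γ u : ℝ) {x : ℝ} (hx : 1 - x ^ 2 < 0) : discW γ u x = 0 :=
  if_neg (by nlinarith [sq_nonneg u])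

lemma gegW_of_neg (a : ℝ) {x : ℝ} (hx : 1 - x ^ 2 < 0) : gegW a x = 0 :=
  gegW_of_notMem fun h => by nlinarith [h.1, h.2]

lemma ae_one_sub_sq_ne_zero : ∀ᵐ x : ℝ, 1 - x ^ 2 ≠ 0 := by
  filter_upwards [Measure.ae_ne volume (1:ℝ), Measure.ae_ne volume (-1:ℝ)] with x h1 h2 h
  rcases mul_eq_zero.mp (by linarith : (x - 1) * (x + 1) = 0) with h | h
  · exact h1 (by linarith)
  · exact h2 (by linarith)

lemma integrable_discW_left {γ : ℝ} (hγ : -1 < γ) {x : ℝ} (hx : 1 - x ^ 2 ≠ 0) :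
    Integrable fun u => discW γ u x := by
  rcases hx.lt_or_gt with h | h
  · simp only [discW_of_neg γ _ h]
    exact integrable_zero _ _ _
  · rw [← integrable_comp_mul_left_iff _ (Real.sqrt_pos.mpr h).ne']
    simp only [discW_sqrt_mul γ h]
    exact (integrable_gegW hγ).const_mul _

lemma integral_discW_mul_left (γ : ℝ) {x : ℝ} (hx : 1 - x ^ 2 ≠ 0) (f : ℝ → ℂ) :
    ∫ u, (discW γ u x : ℂ) * f u =
      (gegW (γ + 1 / 2) x : ℂ) * ∫ s, (gegW γ s : ℂ) * f (√(1 - x ^ 2) * s) := by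
  rcases hx.lt_or_gt with h | h
  · simp [discW_of_neg γ _ h, gegW_of_neg _ h]
  · have hr := Real.sqrt_pos.mpr h
    have h1 := Measure.integral_comp_mul_left (fun u => (discW γ u x : ℂ) * f u) √(1 - x ^ 2)
    have h2 : gegW (γ + 1 / 2) x = √(1 - x ^ 2) * (1 - x ^ 2) ^ γ := by
      rw [gegW_of_mem (abs_le.mp (sq_le_one_iff_abs_le_one x |>.mp (by linarith))),
        Real.rpow_add h, Real.sqrt_eq_rpow, mul_comm]
    simp only [discW_sqrt_mul γ h] at h1
    rw [abs_of_pos (inv_pos.mpr hr), eq_inv_smul_iff₀ hr.ne'] at h1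
    rw [← h1, h2, Complex.real_smul, Complex.ofReal_mul, mul_assoc]
    simp only [Complex.ofReal_mul, mul_assoc, integral_const_mul]

lemma integrable_discW {γ : ℝ} (hγ : -1 < γ) :
    Integrable fun p : ℝ × ℝ => discW γ p.1 p.2 := by
  rw [Measure.volume_eq_prod, integrable_prod_iff' (measurable_discW γ).aestronglyMeasurable]
  constructor
  · filter_upwards [ae_one_sub_sq_ne_zero] with x hx using integrable_discW_left hγ hx
  · refine ((integrable_gegW (a := γ + 1 / 2) (by linarith)).mul_const (∫ s, gegW γ s)).congr ?_
    filter_upwards [ae_one_sub_sq_ne_zero] with x hx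
    have h := integral_discW_mul_left γ hx 1
    simp only [Pi.one_apply, mul_one, integral_complex_ofReal] at h
    simp only [Real.norm_of_nonneg (discW_nonneg _ _ _)]
    exact_mod_cast h.symm

lemma norm_sq_mem_closedBall_iff (z : ℂ) :
    z ∈ Metric.closedBall (0:ℂ) 1 ↔ z.re ^ 2 + z.im ^ 2 ≤ 1 := by
  rw [mem_closedBall_zero_iff, ← sq_le_one_iff₀ (norm_nonneg z), Complex.sq_norm,
    Complex.normSq_apply]
  ring_nf

lemma discW_eq_indicator (γ : ℝ) (z : ℂ) : discW γ z.re z.im =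
    (Metric.closedBall (0:ℂ) 1).indicator (fun z => (1 - ‖z‖ ^ 2) ^ γ) z := by
  by_cases hz : z ∈ Metric.closedBall (0:ℂ) 1
  · rw [Set.indicator_of_mem hz, discW, if_pos ((norm_sq_mem_closedBall_iff z).mp hz),
      Complex.sq_norm, Complex.normSq_apply]
    ring_nf
  · rw [Set.indicator_of_notMem hz, discW, if_neg ((norm_sq_mem_closedBall_iff z).not.mp hz)]

lemma isFiniteMeasure_diskMeasure {γ : ℝ} (hγ : -1 < γ) : IsFiniteMeasure (diskMeasure γ) := by
  refine isFiniteMeasure_withDensity_ofReal (Integrable.hasFiniteIntegral ?_)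
  rw [← IntegrableOn, ← integrable_indicator_iff Metric.isClosed_closedBall.measurableSet]
  refine (Complex.volume_preserving_equiv_real_prod.integrable_comp_of_integrable
    (integrable_discW hγ)).congr (ae_of_all _ fun z => ?_)
  exact discW_eq_indicator γ z

lemma integral_diskMeasure (γ : ℝ) (f : ℂ → ℂ) :
    ∫ z, f z ∂(diskMeasure γ) = ∫ z : ℂ, (discW γ z.re z.im : ℂ) * f z := by
  rw [diskMeasure, integral_withDensity_eq_integral_toReal_smul (by fun_prop) (by simp),
    ← integral_indicator Metric.isClosed_closedBall.measurableSet]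
  congr 1; ext z
  rw [discW_eq_indicator]
  by_cases hz : z ∈ Metric.closedBall (0:ℂ) 1
  · rw [Set.indicator_of_mem hz, Set.indicator_of_mem hz, ENNReal.toReal_ofReal, Complex.real_smul]
    rw [mem_closedBall_zero_iff] at hz
    exact Real.rpow_nonneg (by nlinarith [norm_nonneg z]) _
  · rw [Set.indicator_of_notMem hz, Set.indicator_of_notMem hz]; simp

lemma ae_mem_closedBall_diskMeasure (γ : ℝ) :
    ∀ᵐ z ∂(diskMeasure γ), z ∈ Metric.closedBall (0:ℂ) 1 :=
  (withDensity_absolutelyContinuous _ _).ae_le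
    (ae_restrict_mem Metric.isClosed_closedBall.measurableSet)

lemma integrable_diskMeasure {γ : ℝ} (hγ : -1 < γ) {f : ℂ → ℂ} (hf : Continuous f) :
    Integrable f (diskMeasure γ) := by
  have := isFiniteMeasure_diskMeasure hγ
  obtain ⟨C, hC⟩ := (isCompact_closedBall (0:ℂ) 1).exists_bound_of_continuousOn hf.continuousOn
  exact Integrable.of_bound hf.aestronglyMeasurable C
    ((ae_mem_closedBall_diskMeasure γ).mono hC)

lemma integrable_diskMeasure_prod {γ : ℝ} (hγ : -1 < γ) (a b : ℝ) {f : ℂ × ℝ → ℂ}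
    (hf : Continuous f) :
    Integrable f ((diskMeasure γ).prod (volume.restrict (Set.Ioc a b))) := by
  have := isFiniteMeasure_diskMeasure hγ
  obtain ⟨C, hC⟩ := ((isCompact_closedBall (0:ℂ) 1).prod
    (isCompact_Icc (a := a) (b := b))).exists_bound_of_continuousOn hf.continuousOn
  refine Integrable.of_bound hf.aestronglyMeasurable C ?_
  filter_upwards [Measure.quasiMeasurePreserving_fst.ae (ae_mem_closedBall_diskMeasure γ),
    Measure.quasiMeasurePreserving_snd.ae (ae_restrict_mem measurableSet_Ioc)] with p h1 h2
  exact hC p ⟨h1, Set.Ioc_subset_Icc_self h2⟩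

lemma integral_diskMeasure_swap {γ : ℝ} (hγ : -1 < γ) {a b : ℝ} (hab : a ≤ b) {f : ℂ → ℝ → ℂ}
    (hf : Continuous (Function.uncurry f)) :
    ∫ z, (∫ θ in a..b, f z θ) ∂(diskMeasure γ) = ∫ θ in a..b, ∫ z, f z θ ∂(diskMeasure γ) := by
  have := isFiniteMeasure_diskMeasure hγ
  simp only [intervalIntegral.integral_of_le hab]
  exact integral_integral_swap (integrable_diskMeasure_prod hγ a b hf)

/-- Integration over the disk along horizontal chords, rescaled to `[-1, 1]`. -/
lemma integral_diskMeasure_eq_iterated {γ : ℝ} (hγ : -1 < γ) {f : ℂ → ℂ} (hf : Continuous f) :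
    ∫ z, f z ∂(diskMeasure γ) = ∫ x, (gegW (γ + 1 / 2) x : ℂ) *
      ∫ s, (gegW γ s : ℂ) * f ⟨√(1 - x ^ 2) * s, x⟩ := by
  have hint := integrable_diskMeasure hγ hf
  rw [integral_diskMeasure]
  have hint' : Integrable fun p : ℝ × ℝ => (discW γ p.1 p.2 : ℂ) * f ⟨p.1, p.2⟩ := by
    rw [diskMeasure, integrable_withDensity_iff_integrable_smul' (by fun_prop) (by simp),
      ← IntegrableOn, ← integrable_indicator_iff Metric.isClosed_closedBall.measurableSet] at hint
    rw [← (Complex.volume_preserving_equiv_real_prod.symm).integrable_comp_emb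
      Complex.measurableEquivRealProd.symm.measurableEmbedding] at hint
    refine hint.congr (ae_of_all _ fun p => ?_)
    simp only [Function.comp, Complex.measurableEquivRealProd_symm_apply]
    have h := discW_eq_indicator γ ⟨p.1, p.2⟩
    simp only at h
    rw [h]
    by_cases hz : (⟨p.1, p.2⟩ : ℂ) ∈ Metric.closedBall (0:ℂ) 1
    · rw [Set.indicator_of_mem hz, Set.indicator_of_mem hz, ENNReal.toReal_ofReal,
        Complex.real_smul]
      rw [mem_closedBall_zero_iff] at hz
      exact Real.rpow_nonneg (by nlinarith [norm_nonneg (⟨p.1, p.2⟩ : ℂ)]) _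
    · rw [Set.indicator_of_notMem hz, Set.indicator_of_notMem hz]; simp
  have h1 := Complex.volume_preserving_equiv_real_prod.integral_comp'
    (fun p : ℝ × ℝ => (discW γ p.1 p.2 : ℂ) * f ⟨p.1, p.2⟩)
  simp only [Complex.measurableEquivRealProd_apply] at h1
  rw [h1, Measure.volume_eq_prod, integral_prod_symm _ (by rwa [← Measure.volume_eq_prod])]
  refine integral_congr_ae ?_
  filter_upwards [ae_one_sub_sq_ne_zero] with x hx
  exact integral_discW_mul_left γ hx fun u => f ⟨u, x⟩

/-- The weighted disk measure is invariant under rotations. -/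
lemma integral_diskMeasure_rotate (γ : ℝ) (θ : ℝ) (f : ℂ → ℂ) :
    ∫ z, f (z * Complex.exp (θ * Complex.I)) ∂(diskMeasure γ) = ∫ z, f z ∂(diskMeasure γ) := by
  have hmp := (rotation (Circle.exp θ)).measurePreserving
  have h := hmp.integral_comp (rotation (Circle.exp θ)).toHomeomorph.measurableEmbedding
    (fun z : ℂ => (discW γ z.re z.im : ℂ) * f z)
  rw [integral_diskMeasure, integral_diskMeasure, ← h]
  congr 1; ext z
  have h2 : rotation (Circle.exp θ) z = z * Complex.exp (θ * Complex.I) := by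
    rw [rotation_apply, Circle.coe_exp, mul_comm]
  have h3 : ‖z * Complex.exp (θ * Complex.I)‖ = ‖z‖ := by
    rw [norm_mul, Complex.norm_exp_ofReal_mul_I, mul_one]
  simp only [h2, discW_eq_indicator, Set.indicator, mem_closedBall_zero_iff, h3]

/-- The polynomial `x ↦ ∫ (1 - s²)^γ (d √(1 - x²) s + c x)^j ds`. -/
def chordPoly (γ : ℝ) (c d : ℂ) (j : ℕ) : Polynomial ℂ :=
  ∑ i ∈ Finset.range (j + 1),
    Polynomial.C (d ^ i * c ^ (j - i) * (j.choose i) * ∫ s, (gegW γ s : ℂ) * (s : ℂ) ^ i) *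
      (Polynomial.X ^ (j - i) * (1 - Polynomial.X ^ 2) ^ (i / 2))

lemma natDegree_one_sub_sq_le :
    (1 - Polynomial.X ^ 2 : Polynomial ℂ).natDegree ≤ 2 := by
  compute_degree

lemma natDegree_chordPoly_le (γ : ℝ) (c d : ℂ) (j : ℕ) :
    (chordPoly γ c d j).natDegree ≤ j := by
  refine Polynomial.natDegree_sum_le_of_forall_le _ _ fun i hi => ?_
  have hi' : i ≤ j := Nat.lt_succ_iff.mp (Finset.mem_range.mp hi)
  refine (Polynomial.natDegree_C_mul_le _ _).trans (Polynomial.natDegree_mul_le.trans ?_)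
  have h1 := Polynomial.natDegree_pow_le (p := (1 - Polynomial.X ^ 2 : Polynomial ℂ)) (n := i / 2)
  have h2 := Nat.mul_le_mul_left (i / 2) natDegree_one_sub_sq_le
  rw [Polynomial.natDegree_X_pow]
  omega

lemma coeff_one_sub_sq_pow (m : ℕ) :
    ((1 - Polynomial.X ^ 2 : Polynomial ℂ) ^ m).coeff (2 * m) = (-1) ^ m := by
  have h := Polynomial.coeff_pow_of_natDegree_le natDegree_one_sub_sq_le (m := m)
  rw [mul_comm 2 m, h]
  congr 1
  simp [Polynomial.coeff_one]

lemma coeff_chordPoly_self {γ : ℝ} (hγ : -1 < γ) (c d : ℂ) (j : ℕ) :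
    (chordPoly γ c d j).coeff j =
      ∫ s, (gegW γ s : ℂ) * (Complex.I * d * s + c) ^ j := by
  have h : ∀ s : ℝ, (gegW γ s : ℂ) * (Complex.I * d * s + c) ^ j =
      ∑ i ∈ Finset.range (j + 1), (Complex.I * d) ^ i * c ^ (j - i) * (j.choose i) *
        ((gegW γ s : ℂ) * (s : ℂ) ^ i) := by
    intro s
    rw [add_pow, Finset.mul_sum]
    exact Finset.sum_congr rfl fun i _ => by ring
  simp only [h]
  rw [integral_finsetSum _ fun i _ => (integrable_gegW_mul hγ (by fun_prop)).const_mul _,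
    chordPoly, Polynomial.finsetSum_coeff]
  refine Finset.sum_congr rfl fun i hi => ?_
  have hi' : i ≤ j := Nat.lt_succ_iff.mp (Finset.mem_range.mp hi)
  rw [integral_const_mul, Polynomial.coeff_C_mul]
  rcases Nat.even_or_odd' i with ⟨m, rfl | rfl⟩
  · have h3 : (2 * m) / 2 = m := by omega
    have h4 := Polynomial.coeff_X_pow_mul ((1 - Polynomial.X ^ 2 : Polynomial ℂ) ^ m)
      (j - 2 * m) (2 * m)
    rw [Nat.add_sub_cancel' hi'] at h4
    rw [h3, h4, coeff_one_sub_sq_pow, mul_pow, pow_mul Complex.I, Complex.I_sq]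
    ring
  · rw [integral_gegW_mul_pow_of_odd γ ⟨m, rfl⟩]
    simp

lemma eval_chordPoly {γ : ℝ} (hγ : -1 < γ) (c d : ℂ) (j : ℕ) {x : ℝ} (hx : 0 ≤ 1 - x ^ 2) :
    (chordPoly γ c d j).eval (x : ℂ) =
      ∫ s, (gegW γ s : ℂ) * (d * (√(1 - x ^ 2) * s : ℝ) + c * x) ^ j := by
  have h : ∀ s : ℝ, (gegW γ s : ℂ) * (d * (√(1 - x ^ 2) * s : ℝ) + c * x) ^ j =
      ∑ i ∈ Finset.range (j + 1), (d * √(1 - x ^ 2)) ^ i * (c * x) ^ (j - i) * (j.choose i) *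
        ((gegW γ s : ℂ) * (s : ℂ) ^ i) := by
    intro s
    rw [add_pow, Finset.mul_sum]
    exact Finset.sum_congr rfl fun i _ => by push_cast; ring
  simp only [h]
  rw [integral_finsetSum _ fun i _ => (integrable_gegW_mul hγ (by fun_prop)).const_mul _,
    chordPoly, Polynomial.eval_finsetSum]
  refine Finset.sum_congr rfl fun i hi => ?_
  rw [integral_const_mul]
  simp only [Polynomial.eval_mul, Polynomial.eval_C, Polynomial.eval_pow, Polynomial.eval_X,
    Polynomial.eval_sub, Polynomial.eval_one]
  rcases Nat.even_or_odd' i with ⟨m, rfl | rfl⟩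
  · have h3 : (2 * m) / 2 = m := by omega
    have h4 : ((√(1 - x ^ 2) : ℝ) : ℂ) ^ 2 = 1 - (x : ℂ) ^ 2 := by
      rw [← Complex.ofReal_pow, Real.sq_sqrt hx]; push_cast; rfl
    rw [h3, mul_pow d, pow_mul (√(1 - x ^ 2) : ℂ), h4]
    ring
  · rw [integral_gegW_mul_pow_of_odd γ ⟨m, rfl⟩]
    simp

/-- The squared norm of `L n` for the weight `(1 - x²)^(γ + 1/2)`. -/
def sqNormL (γ : ℝ) (L : ℕ → Polynomial ℝ) (n : ℕ) : ℝ :=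
  ∫ x, gegW (γ + 1 / 2) x * (L n).eval x ^ 2

lemma integral_ortho_pow {γ : ℝ} {L : ℕ → Polynomial ℝ} (hL : IsMonicOrtho γ L) {n m : ℕ}
    (hm : m < n) :
    ∫ x, (gegW (γ + 1 / 2) x : ℂ) * (((L n).eval x : ℝ) * (x : ℂ) ^ m) = 0 := by
  have h := (hL n).2.2 m hm
  rw [integral_gegW_mul (γ + 1 / 2) fun x => (((L n).eval x : ℝ) : ℂ) * (x : ℂ) ^ m]
  rw [← Complex.ofReal_eq_zero, ← intervalIntegral.integral_ofReal] at h
  rw [← h]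
  refine intervalIntegral.integral_congr fun x _ => ?_
  push_cast
  ring

lemma integral_ortho_polynomial_aux {γ : ℝ} (hγ : -1 < γ) {L : ℕ → Polynomial ℝ}
    (hL : IsMonicOrtho γ L) {n : ℕ} {q : Polynomial ℂ} (hq : q.natDegree ≤ n) :
    ∫ x, (gegW (γ + 1 / 2) x : ℂ) * (((L n).eval x : ℝ) * q.eval (x : ℂ)) =
      q.coeff n * ∫ x, (gegW (γ + 1 / 2) x : ℂ) * (((L n).eval x : ℝ) * (x : ℂ) ^ n) := by
  have h : ∀ x : ℝ, (gegW (γ + 1 / 2) x : ℂ) * (((L n).eval x : ℝ) * q.eval (x : ℂ)) =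
      ∑ i ∈ Finset.range (n + 1), q.coeff i *
        ((gegW (γ + 1 / 2) x : ℂ) * (((L n).eval x : ℝ) * (x : ℂ) ^ i)) := by
    intro x
    rw [Polynomial.eval_eq_sum_range' (Nat.lt_succ_iff.mpr hq), Finset.mul_sum, Finset.mul_sum]
    exact Finset.sum_congr rfl fun i _ => by ring
  simp only [h]
  rw [integral_finsetSum _ fun i _ => (integrable_gegW_mul (by linarith) (by fun_prop)).const_mul _,
    Finset.sum_range_succ, integral_const_mul, Finset.sum_eq_zero, zero_add]
  intro i hi
  rw [integral_const_mul, integral_ortho_pow hL (Finset.mem_range.mp hi), mul_zero]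

/-- Pairing `L n` with a polynomial of degree at most `n` sees only the top coefficient. -/
lemma integral_ortho_polynomial {γ : ℝ} (hγ : -1 < γ) {L : ℕ → Polynomial ℝ}
    (hL : IsMonicOrtho γ L) {n : ℕ} {q : Polynomial ℂ} (hq : q.natDegree ≤ n) :
    ∫ x, (gegW (γ + 1 / 2) x : ℂ) * (((L n).eval x : ℝ) * q.eval (x : ℂ)) =
      q.coeff n * sqNormL γ L n := by
  rw [integral_ortho_polynomial_aux hγ hL hq]
  have h := integral_ortho_polynomial_aux hγ hL (q := (L n).map Complex.ofRealHom)
    (Polynomial.natDegree_map_le.trans (hL n).2.1.le)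
  have h1 : (L n).coeff n = 1 := by
    have := (hL n).1.coeff_natDegree
    rwa [(hL n).2.1] at this
  rw [Polynomial.coeff_map, h1, map_one, one_mul] at h
  rw [← h, sqNormL, ← integral_complex_ofReal]
  congr 2; ext x
  rw [Polynomial.eval_map, ← Complex.ofRealHom_eq_coe x, Polynomial.eval₂_hom,
    Complex.ofRealHom_eq_coe]
  push_cast
  ring

lemma sqNormL_pos {γ : ℝ} (hγ : -1 < γ) {L : ℕ → Polynomial ℝ} (hL : IsMonicOrtho γ L) (n : ℕ) :
    0 < sqNormL γ L n := by
  have hint : Integrable fun x => gegW (γ + 1 / 2) x * (L n).eval x ^ 2 := by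
    have h := (integrable_gegW_mul (a := γ + 1 / 2) (by linarith)
      (f := fun x => (((L n).eval x ^ 2 : ℝ) : ℂ)) (by fun_prop)).re
    refine h.congr (ae_of_all _ fun x => ?_)
    simp only [← Complex.ofReal_mul]
    exact Complex.ofReal_re _
  rw [sqNormL, integral_pos_iff_support_of_nonneg
    (fun x => mul_nonneg (gegW_nonneg _ _) (sq_nonneg _)) hint]
  have hsub : Set.Ioo (-1:ℝ) 1 \ ((L n).roots.toFinset : Set ℝ) ⊆
      Function.support fun x => gegW (γ + 1 / 2) x * (L n).eval x ^ 2 := by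
    rintro x ⟨hx, hr⟩
    have h1 : (L n).eval x ≠ 0 := by
      intro h0
      exact hr (by simp [(hL n).1.ne_zero, h0])
    have h2 : 0 < gegW (γ + 1 / 2) x := by
      rw [gegW_of_mem (Set.Ioo_subset_Icc_self hx)]
      exact Real.rpow_pos_of_pos (by nlinarith [hx.1, hx.2]) _
    exact (mul_pos h2 (by positivity)).ne'
  refine lt_of_lt_of_le ?_ (measure_mono hsub)
  rw [measure_sdiff_null ((L n).roots.toFinset.finite_toSet.measure_zero _), Real.volume_Ioo]
  norm_num

/-- The plane wave `z ↦ L_n (Im z)`. -/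
def ridge (L : ℕ → Polynomial ℝ) (n : ℕ) (z : ℂ) : ℂ := ((L n).eval z.im : ℝ)

@[fun_prop]
lemma continuous_ridge (L : ℕ → Polynomial ℝ) (n : ℕ) : Continuous (ridge L n) := by
  unfold ridge
  exact Complex.continuous_ofReal.comp ((L n).continuous.comp Complex.continuous_im)

lemma conj_ridge (L : ℕ → Polynomial ℝ) (n : ℕ) (z : ℂ) :
    (starRingEnd ℂ) (ridge L n z) = ridge L n z := Complex.conj_ofReal _

lemma im_mul_exp_neg (u x θ : ℝ) :
    ((⟨u, x⟩ : ℂ) * Complex.exp (-(θ : ℂ) * Complex.I)).im =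
      -Real.sin θ * u + Real.cos θ * x := by
  rw [← Complex.ofReal_neg, Complex.exp_mul_I, ← Complex.ofReal_cos, ← Complex.ofReal_sin]
  simp [-Complex.ofReal_cos, -Complex.ofReal_sin]
  ring

/-- The correlation of two plane waves in directions differing by the angle `θ`. -/
lemma integral_ridge_mul_ridge {γ : ℝ} (hγ : -1 < γ) {L : ℕ → Polynomial ℝ}
    (hL : IsMonicOrtho γ L) (n : ℕ) (θ : ℝ) :
    ∫ z, ridge L n z * ridge L n (z * Complex.exp (-(θ : ℂ) * Complex.I)) ∂(diskMeasure γ) =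
      sqNormL γ L n * ∫ s, (gegW γ s : ℂ) *
        ((1 - s) / 2 * Complex.exp (θ * Complex.I) +
          (1 + s) / 2 * Complex.exp (-(θ * Complex.I))) ^ n := by
  rw [integral_diskMeasure_eq_iterated hγ (by fun_prop)]
  set q : Polynomial ℂ := ∑ j ∈ Finset.range (n + 1),
    Polynomial.C (((L n).coeff j : ℝ) : ℂ) * chordPoly γ (Real.cos θ) (-Real.sin θ) j with hq
  have hdeg : q.natDegree ≤ n := by
    refine Polynomial.natDegree_sum_le_of_forall_le _ _ fun j hj => ?_
    exact (Polynomial.natDegree_C_mul_le _ _).trans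
      ((natDegree_chordPoly_le _ _ _ _).trans (Nat.lt_succ_iff.mp (Finset.mem_range.mp hj)))
  have hLn : (L n).coeff n = 1 := by
    have := (hL n).1.coeff_natDegree
    rwa [(hL n).2.1] at this
  have hcoeff : q.coeff n = (chordPoly γ (Real.cos θ) (-Real.sin θ) n).coeff n := by
    rw [hq, Polynomial.finsetSum_coeff, Finset.sum_range_succ, Finset.sum_eq_zero, zero_add,
      Polynomial.coeff_C_mul, hLn, Complex.ofReal_one, one_mul]
    intro j hj
    rw [Polynomial.coeff_C_mul, Polynomial.coeff_eq_zero_of_natDegree_lt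
      ((natDegree_chordPoly_le _ _ _ _).trans_lt (Finset.mem_range.mp hj)), mul_zero]
  have hinner : ∀ x : ℝ, (gegW (γ + 1 / 2) x : ℂ) *
      ∫ s, (gegW γ s : ℂ) * (ridge L n ⟨√(1 - x ^ 2) * s, x⟩ *
        ridge L n ((⟨√(1 - x ^ 2) * s, x⟩ : ℂ) * Complex.exp (-(θ : ℂ) * Complex.I))) =
      (gegW (γ + 1 / 2) x : ℂ) * (((L n).eval x : ℝ) * q.eval (x : ℂ)) := by
    intro x
    by_cases hx : 0 ≤ 1 - x ^ 2
    · congr 1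
      rw [hq, Polynomial.eval_finsetSum]
      simp only [Polynomial.eval_mul, Polynomial.eval_C, eval_chordPoly hγ _ _ _ hx, ridge,
        im_mul_exp_neg]
      have h : ∀ s : ℝ, (gegW γ s : ℂ) * (((L n).eval x : ℝ) *
          ((L n).eval (-Real.sin θ * (√(1 - x ^ 2) * s) + Real.cos θ * x) : ℝ)) =
          ((L n).eval x : ℝ) * ∑ j ∈ Finset.range (n + 1), (((L n).coeff j : ℝ) : ℂ) *
            ((gegW γ s : ℂ) *
              (-Real.sin θ * (√(1 - x ^ 2) * s : ℝ) + Real.cos θ * x) ^ j) := by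
        intro s
        rw [Polynomial.eval_eq_sum_range' (Nat.lt_succ_iff.mpr (hL n).2.1.le) (_ + _)]
        push_cast
        rw [mul_left_comm, Finset.mul_sum]
        congr 1
        exact Finset.sum_congr rfl fun j _ => by ring
      simp only [h]
      rw [integral_const_mul, integral_finsetSum _ fun i _ =>
        (integrable_gegW_mul hγ (by fun_prop)).const_mul _]
      simp only [integral_const_mul]
    · rw [gegW_of_neg _ (not_le.mp hx)]
      simp
  simp only [hinner]
  rw [integral_ortho_polynomial hγ hL hdeg, hcoeff, coeff_chordPoly_self hγ, mul_comm]
  congr 2; ext s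
  rw [← neg_mul, ← Complex.ofReal_neg, Complex.exp_mul_I, Complex.exp_mul_I]
  push_cast
  rw [Complex.cos_neg, Complex.sin_neg]
  ring_nf

lemma integral_exp_int_mul (j : ℤ) :
    ∫ θ in (0:ℝ)..(2 * π), Complex.exp (j * (θ * Complex.I)) = if j = 0 then 2 * π else 0 := by
  split_ifs with h
  · simp [h]
  · have hc : (j : ℂ) * Complex.I ≠ 0 := mul_ne_zero (by exact_mod_cast h) Complex.I_ne_zero
    have h1 : ∀ θ : ℝ, (j : ℂ) * (θ * Complex.I) = j * Complex.I * θ := fun θ => by ring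
    simp only [h1]
    rw [integral_exp_mul_complex hc]
    have h2 : (j : ℂ) * Complex.I * ((2 * π : ℝ) : ℂ) = j * (2 * π * Complex.I) := by
      push_cast; ring
    rw [h2, Complex.exp_int_mul_two_pi_mul_I]
    simp

lemma integral_exp_mul_ridge_correlation {γ : ℝ} (hγ : -1 < γ) {L : ℕ → Polynomial ℝ}
    (hL : IsMonicOrtho γ L) {n k : ℕ} (hk : k ≤ n) :
    ∫ θ in (0:ℝ)..(2 * π), Complex.exp (-(((n : ℤ) - 2 * k : ℤ) * (θ * Complex.I))) *
      ∫ z, ridge L n z * ridge L n (z * Complex.exp (-(θ : ℂ) * Complex.I)) ∂(diskMeasure γ) =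
    ((2 * π * sqNormL γ L n * (n.choose k) * (2 ^ (2 * γ + 1) *
      (Real.Gamma ((n - k : ℕ) + γ + 1) * Real.Gamma (k + γ + 1) /
        Real.Gamma ((n - k : ℕ) + k + 2 * γ + 2))) : ℝ) : ℂ) := by
  have hB : ∀ l : ℕ, Integrable fun s : ℝ =>
      (gegW γ s : ℂ) * (((1 - s) / 2) ^ l * ((1 + s) / 2) ^ (n - l)) :=
    fun l => integrable_gegW_mul hγ (by fun_prop)
  have h : ∀ θ : ℝ, Complex.exp (-(((n : ℤ) - 2 * k : ℤ) * (θ * Complex.I))) *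
      ∫ z, ridge L n z * ridge L n (z * Complex.exp (-(θ : ℂ) * Complex.I)) ∂(diskMeasure γ) =
      ∑ l ∈ Finset.range (n + 1), (sqNormL γ L n * (n.choose l) *
        (∫ s, (gegW γ s : ℂ) * (((1 - s) / 2) ^ l * ((1 + s) / 2) ^ (n - l)))) *
          Complex.exp ((2 * (l + k - n) : ℤ) * (θ * Complex.I)) := by
    intro θ
    have hs : ∀ s : ℝ, (gegW γ s : ℂ) * ((1 - s) / 2 * Complex.exp (θ * Complex.I) +
          (1 + s) / 2 * Complex.exp (-(θ * Complex.I))) ^ n =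
        ∑ l ∈ Finset.range (n + 1), (n.choose l * Complex.exp ((2 * l - n : ℤ) * (θ * Complex.I)))
          * ((gegW γ s : ℂ) * (((1 - s) / 2) ^ l * ((1 + s) / 2) ^ (n - l))) := by
      intro s
      rw [add_pow, Finset.mul_sum]
      refine Finset.sum_congr rfl fun l hl => ?_
      have hl' : l ≤ n := Nat.lt_succ_iff.mp (Finset.mem_range.mp hl)
      have he : Complex.exp ((2 * l - n : ℤ) * (θ * Complex.I)) =
          Complex.exp (θ * Complex.I) ^ l * Complex.exp (-(θ * Complex.I)) ^ (n - l) := by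
        rw [← Complex.exp_nat_mul, ← Complex.exp_nat_mul, ← Complex.exp_add]
        congr 1
        push_cast [Nat.cast_sub hl']
        ring
      rw [he, mul_pow, mul_pow]
      ring
    rw [integral_ridge_mul_ridge hγ hL]
    simp only [hs]
    rw [integral_finsetSum _ fun l _ => (hB l).const_mul _]
    simp only [integral_const_mul]
    rw [Finset.mul_sum, Finset.mul_sum]
    refine Finset.sum_congr rfl fun l _ => ?_
    have he : Complex.exp ((2 * (l + k - n) : ℤ) * (θ * Complex.I)) =
        Complex.exp (-(((n : ℤ) - 2 * k : ℤ) * (θ * Complex.I))) *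
          Complex.exp ((2 * l - n : ℤ) * (θ * Complex.I)) := by
      rw [← Complex.exp_add]
      congr 1
      push_cast
      ring
    rw [he]
    ring
  simp only [h]
  rw [intervalIntegral.integral_finsetSum fun l _ =>
    (Continuous.intervalIntegrable (by fun_prop) _ _)]
  simp only [intervalIntegral.integral_const_mul, integral_exp_int_mul]
  rw [Finset.sum_eq_single (n - k)]
  · rw [if_pos (by omega), integral_gegW_bernstein hγ, Nat.sub_sub_self hk, Nat.choose_symm hk]
    push_cast
    ring
  · intro l _ hl
    rw [if_neg (by omega), Complex.ofReal_zero, mul_zero]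
  · intro hl
    exact absurd (Finset.mem_range.mpr (by omega)) hl

lemma GZ_eq (γ : ℝ) (L : ℕ → Polynomial ℝ) (n k : ℕ) (z : ℂ) :
    GZ γ L n (k : ℤ) z = ((1 / (2 * π) : ℝ) : ℂ) * ∫ θ in (0:ℝ)..(2 * π),
      Complex.exp (((n : ℤ) - 2 * k : ℤ) * (θ * Complex.I)) *
        ridge L n (z * Complex.exp (-(θ : ℂ) * Complex.I)) := by
  unfold GZ
  congr 1
  refine intervalIntegral.integral_congr fun θ _ => ?_
  have h1 : Complex.I * ((n : ℂ) - 2 * ((k : ℤ) : ℂ)) * (θ : ℂ) =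
      ((n : ℤ) - 2 * k : ℤ) * (θ * Complex.I) := by push_cast; ring
  have h2 : (Complex.I / 2) * ((starRingEnd ℂ) z * Complex.exp ((θ : ℂ) * Complex.I) -
      z * Complex.exp (-(θ : ℂ) * Complex.I)) =
      ((z * Complex.exp (-(θ : ℂ) * Complex.I)).im : ℂ) := by
    have hc : (starRingEnd ℂ) (z * Complex.exp (-(θ : ℂ) * Complex.I)) =
        (starRingEnd ℂ) z * Complex.exp ((θ : ℂ) * Complex.I) := by
      rw [map_mul, ← Complex.exp_conj]
      simp
    rw [Complex.im_eq_sub_conj, hc, eq_div_iff (by simp)]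
    ring_nf
    rw [Complex.I_sq]
    ring
  simp only [h1, h2, ridge]
  rw [← Complex.coe_algebraMap, Polynomial.aeval_algebraMap_apply]
  simp

lemma continuous_GZ_integrand (L : ℕ → Polynomial ℝ) (n : ℕ) (m : ℤ) :
    Continuous (Function.uncurry fun (z : ℂ) (θ : ℝ) =>
      Complex.exp (m * (θ * Complex.I)) *
        ridge L n (z * Complex.exp (-(θ : ℂ) * Complex.I))) := by
  unfold Function.uncurry
  fun_prop

lemma continuous_GZ (γ : ℝ) (L : ℕ → Polynomial ℝ) (n k : ℕ) :
    Continuous (GZ γ L n (k : ℤ)) := by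
  rw [show GZ γ L n (k : ℤ) = _ from funext (GZ_eq γ L n k)]
  exact continuous_const.mul
    (intervalIntegral.continuous_parametric_intervalIntegral_of_continuous'
      (continuous_GZ_integrand L n _) _ _)

lemma GZ_mul_exp (γ : ℝ) (L : ℕ → Polynomial ℝ) (n k : ℕ) (z : ℂ) (φ : ℝ) :
    GZ γ L n (k : ℤ) (z * Complex.exp (φ * Complex.I)) =
      Complex.exp (((n : ℤ) - 2 * k : ℤ) * (φ * Complex.I)) * GZ γ L n (k : ℤ) z := by
  set m : ℤ := (n : ℤ) - 2 * k with hm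
  set g : ℝ → ℂ := fun θ => Complex.exp (m * (θ * Complex.I)) *
    ridge L n (z * Complex.exp (-(θ : ℂ) * Complex.I)) with hg
  have hper : Function.Periodic g (2 * π) := by
    intro θ
    have h1 : (m : ℂ) * (((θ + 2 * π : ℝ) : ℂ) * Complex.I) =
        m * (θ * Complex.I) + m * (2 * π * Complex.I) := by push_cast; ring
    have h2 : -((θ + 2 * π : ℝ) : ℂ) * Complex.I =
        -(θ : ℂ) * Complex.I + (-1 : ℤ) * (2 * π * Complex.I) := by push_cast; ring
    simp only [hg]
    rw [h1, h2, Complex.exp_add, Complex.exp_add, Complex.exp_int_mul_two_pi_mul_I,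
      Complex.exp_int_mul_two_pi_mul_I, mul_one, mul_one]
  have h3 : ∀ θ : ℝ, Complex.exp (m * (θ * Complex.I)) *
      ridge L n (z * Complex.exp (φ * Complex.I) * Complex.exp (-(θ : ℂ) * Complex.I)) =
      Complex.exp (m * (φ * Complex.I)) * g (θ - φ) := by
    intro θ
    simp only [hg]
    rw [← mul_assoc (Complex.exp (m * (φ * Complex.I))), ← Complex.exp_add, mul_assoc z,
      ← Complex.exp_add]
    congr 3 <;> push_cast <;> ring_nf
  rw [GZ_eq, GZ_eq]
  simp only [← hm, h3]
  rw [intervalIntegral.integral_const_mul, intervalIntegral.integral_comp_sub_right g φ,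
    show 2 * π - φ = (0 - φ) + 2 * π by ring, hper.intervalIntegral_add_eq (0 - φ) 0, zero_add]
  ring

/-- The squared norm of `GZ` is its pairing with a single plane wave. -/
lemma integral_norm_GZ_sq_eq_ridge {γ : ℝ} (hγ : -1 < γ) (L : ℕ → Polynomial ℝ) (n k : ℕ) :
    ∫ z, GZ γ L n (k : ℤ) z * (starRingEnd ℂ) (GZ γ L n (k : ℤ) z) ∂(diskMeasure γ) =
      ∫ z, ridge L n z * (starRingEnd ℂ) (GZ γ L n (k : ℤ) z) ∂(diskMeasure γ) := by
  set m : ℤ := (n : ℤ) - 2 * k with hm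
  have hG := continuous_GZ γ L n k
  have hGc : Continuous fun z => (starRingEnd ℂ) (GZ γ L n (k : ℤ) z) :=
    Complex.continuous_conj.comp hG
  have h1 : ∀ z, GZ γ L n (k : ℤ) z * (starRingEnd ℂ) (GZ γ L n (k : ℤ) z) =
      ((1 / (2 * π) : ℝ) : ℂ) * ∫ θ in (0:ℝ)..(2 * π), Complex.exp (m * (θ * Complex.I)) *
        ridge L n (z * Complex.exp (-(θ : ℂ) * Complex.I)) *
          (starRingEnd ℂ) (GZ γ L n (k : ℤ) z) := by
    intro z
    rw [intervalIntegral.integral_mul_const, ← mul_assoc, ← GZ_eq]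
  have hcont : Continuous (Function.uncurry fun (z : ℂ) (θ : ℝ) =>
      Complex.exp (m * (θ * Complex.I)) *
        ridge L n (z * Complex.exp (-(θ : ℂ) * Complex.I)) *
          (starRingEnd ℂ) (GZ γ L n (k : ℤ) z)) :=
    (continuous_GZ_integrand L n m).mul (hGc.comp continuous_fst)
  simp only [h1]
  rw [integral_const_mul, integral_diskMeasure_swap hγ Real.two_pi_pos.le hcont]
  have h2 : ∀ θ : ℝ, ∫ z, Complex.exp (m * (θ * Complex.I)) *
        ridge L n (z * Complex.exp (-(θ : ℂ) * Complex.I)) *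
          (starRingEnd ℂ) (GZ γ L n (k : ℤ) z) ∂(diskMeasure γ) =
      ∫ z, ridge L n z * (starRingEnd ℂ) (GZ γ L n (k : ℤ) z) ∂(diskMeasure γ) := by
    intro θ
    rw [← integral_diskMeasure_rotate γ θ]
    congr 1; ext z
    have h3 : z * Complex.exp (θ * Complex.I) * Complex.exp (-(θ : ℂ) * Complex.I) = z := by
      rw [mul_assoc, ← Complex.exp_add]
      simp
    have h4 : Complex.exp (m * (θ * Complex.I)) *
        (starRingEnd ℂ) (Complex.exp (m * (θ * Complex.I))) = 1 := by
      rw [← Complex.exp_conj, ← Complex.exp_add]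
      simp
    rw [h3, GZ_mul_exp, ← hm, map_mul]
    linear_combination (ridge L n z * (starRingEnd ℂ) (GZ γ L n (k : ℤ) z)) * h4
  simp only [h2]
  rw [intervalIntegral.integral_const, sub_zero, Complex.real_smul, ← mul_assoc,
    ← Complex.ofReal_mul, one_div_mul_cancel Real.two_pi_pos.ne', Complex.ofReal_one, one_mul]

lemma integral_norm_GZ_sq {γ : ℝ} (hγ : -1 < γ) {L : ℕ → Polynomial ℝ}
    (hL : IsMonicOrtho γ L) {n k : ℕ} (hk : k ≤ n) :
    ∫ z, ‖GZ γ L n (k : ℤ) z‖ ^ 2 ∂(diskMeasure γ) =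
      sqNormL γ L n * (n.choose k) * (2 ^ (2 * γ + 1) *
        (Real.Gamma ((n - k : ℕ) + γ + 1) * Real.Gamma (k + γ + 1) /
          Real.Gamma ((n - k : ℕ) + k + 2 * γ + 2))) := by
  set m : ℤ := (n : ℤ) - 2 * k with hm
  apply Complex.ofReal_injective
  rw [← integral_complex_ofReal]
  have h1 : ∀ z, ((‖GZ γ L n (k : ℤ) z‖ ^ 2 : ℝ) : ℂ) =
      GZ γ L n (k : ℤ) z * (starRingEnd ℂ) (GZ γ L n (k : ℤ) z) := by
    intro z
    rw [Complex.mul_conj, Complex.normSq_eq_norm_sq]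
  have h2 : ∀ z, ridge L n z * (starRingEnd ℂ) (GZ γ L n (k : ℤ) z) =
      ((1 / (2 * π) : ℝ) : ℂ) * ∫ θ in (0:ℝ)..(2 * π), Complex.exp (-(m * (θ * Complex.I))) *
        (ridge L n z * ridge L n (z * Complex.exp (-(θ : ℂ) * Complex.I))) := by
    intro z
    rw [GZ_eq, map_mul, Complex.conj_ofReal, ← intervalIntegral.intervalIntegral_conj, mul_left_comm,
      ← intervalIntegral.integral_const_mul]
    congr 1
    refine intervalIntegral.integral_congr fun θ _ => ?_
    simp only [map_mul, conj_ridge, ← Complex.exp_conj, Complex.conj_I, Complex.conj_ofReal,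
      map_intCast, mul_neg, ← hm]
    ring
  have hcont : Continuous (Function.uncurry fun (z : ℂ) (θ : ℝ) =>
      Complex.exp (-(m * (θ * Complex.I))) *
        (ridge L n z * ridge L n (z * Complex.exp (-(θ : ℂ) * Complex.I)))) := by
    unfold Function.uncurry
    fun_prop
  simp only [h1]
  rw [integral_norm_GZ_sq_eq_ridge hγ]
  simp only [h2]
  rw [integral_const_mul, integral_diskMeasure_swap hγ Real.two_pi_pos.le hcont]
  simp only [integral_const_mul]
  rw [hm, integral_exp_mul_ridge_correlation hγ hL hk, ← Complex.ofReal_mul]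
  congr 1
  field_simp

lemma integral_cos_rpow_mul_sq (γ : ℝ) (L : ℕ → Polynomial ℝ) (n : ℕ) :
    ∫ α in Set.Icc (-(π / 2)) (π / 2),
      Real.cos α ^ (2 * γ + 2) * (L n).eval (Real.sin α) ^ 2 = sqNormL γ L n := by
  have himg : Real.sin '' Set.Ioo (-(π / 2)) (π / 2) = Set.Ioo (-1) 1 := by
    ext x
    constructor
    · rintro ⟨a, ha, rfl⟩
      exact Real.mapsTo_sin_Ioo ha
    · intro hx
      exact ⟨Real.arcsin x, ⟨Real.neg_pi_div_two_lt_arcsin.mpr hx.1,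
        Real.arcsin_lt_pi_div_two.mpr hx.2⟩, Real.sin_arcsin hx.1.le hx.2.le⟩
  have h := integral_image_eq_integral_abs_deriv_smul
    (s := Set.Ioo (-(π / 2)) (π / 2)) measurableSet_Ioo
    (fun x _ => (Real.hasDerivAt_sin x).hasDerivWithinAt)
    (Real.injOn_sin.mono Set.Ioo_subset_Icc_self)
    (fun x => (1 - x ^ 2) ^ (γ + 1 / 2) * (L n).eval x ^ 2)
  rw [himg] at h
  have h1 : sqNormL γ L n = ∫ x in Set.Ioo (-1:ℝ) 1,
      (1 - x ^ 2) ^ (γ + 1 / 2) * (L n).eval x ^ 2 := by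
    rw [← integral_Icc_eq_integral_Ioo, ← integral_indicator measurableSet_Icc, sqNormL]
    congr 1; ext x
    rw [gegW, Set.indicator_mul_left]
  rw [h1, h, integral_Icc_eq_integral_Ioo]
  refine setIntegral_congr_fun measurableSet_Ioo fun α hα => ?_
  have hc : 0 < Real.cos α := Real.cos_pos_of_mem_Ioo hα
  simp only [smul_eq_mul]
  rw [abs_of_pos hc, ← Real.cos_sq', ← Real.rpow_natCast (Real.cos α) 2, ← Real.rpow_mul hc.le,
    ← mul_assoc]
  congr 1
  rw [show 2 * γ + 2 = 1 + ((2:ℕ):ℝ) * (γ + 1 / 2) by push_cast; ring, Real.rpow_add hc,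
    Real.rpow_one]

lemma norm_psiF_sq (γ : ℝ) (L : ℕ → Polynomial ℝ) (n k : ℕ) (p : ℝ × ℝ) :
    ‖psiF γ L n (k : ℤ) p‖ ^ 2 = 1 / (2 * π) ^ 2 *
      ((Real.cos p.2 ^ (2 * γ + 1)) ^ 2 * (L n).eval (Real.sin p.2) ^ 2) := by
  have h1 : Complex.I * ((n : ℂ) - 2 * ((k : ℤ) : ℂ)) * ((p.1 + p.2 : ℝ) : ℂ) =
      ((((n : ℝ) - 2 * k) * (p.1 + p.2) : ℝ) : ℂ) * Complex.I := by push_cast; ring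
  rw [psiF, h1, norm_mul, norm_mul, norm_mul, Complex.norm_exp_ofReal_mul_I, Complex.norm_real,
    Complex.norm_real, Complex.norm_real, mul_one, mul_pow, mul_pow, Real.norm_eq_abs,
    Real.norm_eq_abs, Real.norm_eq_abs, sq_abs, sq_abs, sq_abs, div_pow, ← pow_mul, mul_comm n 2,
    pow_mul]
  norm_num
  ring

lemma integral_norm_psiF_sq (γ : ℝ) (L : ℕ → Polynomial ℝ) (n k : ℕ) :
    ∫ p, ‖psiF γ L n (k : ℤ) p‖ ^ 2 ∂(bdryMeasure γ) = sqNormL γ L n / (2 * π) := by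
  rw [bdryMeasure, integral_withDensity_eq_integral_toReal_smul (by fun_prop) (by simp)]
  have h0 : ∫ p in Rect, (ENNReal.ofReal (Real.cos p.2 ^ (-(2 * γ)))).toReal •
      ‖psiF γ L n (k : ℤ) p‖ ^ 2 = ∫ p in Rect, (1 / (2 * π) ^ 2) *
        ((Real.cos p.2) ^ (-(2 * γ)) * ((Real.cos p.2 ^ (2 * γ + 1)) ^ 2 *
          (L n).eval (Real.sin p.2) ^ 2)) := by
    refine setIntegral_congr_fun (measurableSet_Ioc.prod measurableSet_Icc) fun p hp => ?_
    have hc : 0 ≤ Real.cos p.2 := Real.cos_nonneg_of_mem_Icc hp.2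
    simp only [smul_eq_mul]
    rw [ENNReal.toReal_ofReal (Real.rpow_nonneg hc _), norm_psiF_sq]
    ring
  rw [h0, Rect, Measure.volume_eq_prod, setIntegral_prod_mul (fun _ : ℝ => 1 / (2 * π) ^ 2)
    (fun α : ℝ => (Real.cos α) ^ (-(2 * γ)) * ((Real.cos α ^ (2 * γ + 1)) ^ 2 *
          (L n).eval (Real.sin α) ^ 2))]
  have h1 : ∫ α in Set.Icc (-(π / 2)) (π / 2), (Real.cos α) ^ (-(2 * γ)) *
      ((Real.cos α ^ (2 * γ + 1)) ^ 2 * (L n).eval (Real.sin α) ^ 2) = sqNormL γ L n := by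
    rw [← integral_cos_rpow_mul_sq, integral_Icc_eq_integral_Ioo, integral_Icc_eq_integral_Ioo]
    refine setIntegral_congr_fun measurableSet_Ioo fun α hα => ?_
    have hc : 0 < Real.cos α := Real.cos_pos_of_mem_Ioo hα
    rw [← mul_assoc, ← Real.rpow_natCast (Real.cos α ^ _) 2, ← Real.rpow_mul hc.le,
      ← Real.rpow_add hc]
    congr 2
    push_cast
    ring
  rw [h1, setIntegral_const]
  simp [Real.volume_real_Ioc, Real.pi_pos.le]
  field_simp

/-- The ratio of squared norms
`‖G_{n,k}^γ‖²_{L²(𝔻, d^γ dz)} / ‖ψ_{n,k}^γ‖²_{L²(∂₊S𝔻, μ^{-2γ} dβ dα)}` equals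
`2^{2γ+2} π binom(n,k) Γ(n-k+γ+1)Γ(k+γ+1)/Γ(n+2γ+2)`. -/
theorem norm_ratio_eq_sigSq (γ : ℝ) (hγ : -1 < γ)
    (L : ℕ → Polynomial ℝ) (hL : IsMonicOrtho γ L) (n k : ℕ) (hk : k ≤ n) :
    (∫ z, ‖GZ γ L n (k : ℤ) z‖ ^ 2 ∂(diskMeasure γ)) /
        (∫ p, ‖psiF γ L n (k : ℤ) p‖ ^ 2 ∂(bdryMeasure γ))
      = sigSq γ n k := by
  have hpos := (sqNormL_pos hγ hL n).ne'
  rw [integral_norm_GZ_sq hγ hL hk, integral_norm_psiF_sq, sigSq, Nat.cast_sub hk,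
    sub_add_cancel, show 2 * γ + 2 = 2 * γ + 1 + 1 by ring, Real.rpow_add two_pos (2 * γ + 1) 1, Real.rpow_one]
  field_simp

end
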